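/- For every Q₁=(q₁,q₂), Q₃=(q₅,q₆) ∈ {0,1}², every sign s ∈ {+1,−1}, and all bits i,j,k,l ∈ {0,1} with i+j odd and k+l odd, the 6-qubit vectors v_{10,s} and v_{11,s} satisfy (I ⊗ I ⊗ P_i ⊗ P_j ⊗ P_k ⊗ P_l) v_{10,s} = s · (√−1)^{i+j+k+l} · (−1)^{k q₅ + l q₆} · v_{10,s} and (I ⊗ I ⊗ P_i ⊗ P_j ⊗ P_k ⊗ P_l) v_{11,s} = s · (√−1)^{i+j+k+l} · (−1)^{k q₅ + l q₆ + i} · v_{11,s}. -/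

import Mathlib

open Matrix Complex

noncomputable section

/-- Single-qubit Pauli X. -/
def Xg : Matrix (Fin 2) (Fin 2) ℂ := !![0, 1; 1, 0]
/-- Single-qubit Pauli Y. -/
def Yg : Matrix (Fin 2) (Fin 2) ℂ := !![0, -Complex.I; Complex.I, 0]
/-- Single-qubit Pauli Z. -/
def Zg : Matrix (Fin 2) (Fin 2) ℂ := !![1, 0; 0, -1]
/-- P₀ = X, P₁ = Y. -/
def Pg : Fin 2 → Matrix (Fin 2) (Fin 2) ℂ := fun i => if i = 0 then Xg else Yg

/-- Tensor (Kronecker) product of `n` single-qubit operators, as a matrix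
indexed by bit strings. -/
def tens {n : ℕ} (M : Fin n → Matrix (Fin 2) (Fin 2) ℂ) :
    Matrix (Fin n → Fin 2) (Fin n → Fin 2) ℂ :=
  Matrix.of fun r c => ∏ m, M m (r m) (c m)

/-- Computational basis vector |q⟩. -/
def ket {n : ℕ} (q : Fin n → Fin 2) : (Fin n → Fin 2) → ℂ :=
  fun r => if r = q then 1 else 0

/-- The eigenvector v_{10,s} of the paper (6 qubits). -/
def v10 (q₁ q₂ q₅ q₆ : Fin 2) (s : ℂ) : (Fin 6 → Fin 2) → ℂ :=
  (- ket ![q₁, q₂, 0, 0, q₅, q₆] + ket ![q₁+1, q₂+1, 0, 0, q₅, q₆]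
    + ket ![q₁, q₂, 0, 0, q₅+1, q₆+1] + ket ![q₁+1, q₂+1, 0, 0, q₅+1, q₆+1])
  + s • (- ket ![q₁+1, q₂+1, 1, 1, q₅, q₆] - ket ![q₁, q₂, 1, 1, q₅, q₆]
    + ket ![q₁+1, q₂+1, 1, 1, q₅+1, q₆+1] - ket ![q₁, q₂, 1, 1, q₅+1, q₆+1])

/-- The eigenvector v_{11,s} of the paper (6 qubits). -/
def v11 (q₁ q₂ q₅ q₆ : Fin 2) (s : ℂ) : (Fin 6 → Fin 2) → ℂ :=
  (- ket ![q₁, q₂, 0, 1, q₅, q₆] + ket ![q₁+1, q₂+1, 0, 1, q₅, q₆]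
    + ket ![q₁, q₂, 0, 1, q₅+1, q₆+1] + ket ![q₁+1, q₂+1, 0, 1, q₅+1, q₆+1])
  + s • (ket ![q₁+1, q₂+1, 1, 0, q₅, q₆] + ket ![q₁, q₂, 1, 0, q₅, q₆]
    - ket ![q₁+1, q₂+1, 1, 0, q₅+1, q₆+1] + ket ![q₁, q₂, 1, 0, q₅+1, q₆+1])

theorem tens_mulVec_ket {n : ℕ} (M : Fin n → Matrix (Fin 2) (Fin 2) ℂ) (q : Fin n → Fin 2) :
    (tens M).mulVec (ket q) = fun r => ∏ m, M m (r m) (q m) := by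
  ext r
  simp [Matrix.mulVec, dotProduct, tens, ket]

theorem Pg_apply (i r b : Fin 2) :
    Pg i r b =
      if r = b + 1 then Complex.I ^ (i : ℕ) * (-1 : ℂ) ^ ((i : ℕ) * (b : ℕ)) else 0 := by
  fin_cases i <;> fin_cases r <;> fin_cases b <;> simp [Pg, Xg, Yg]

theorem tens_Pg_mulVec_ket (i j k l a b c d e f : Fin 2) :
    (tens ![1, 1, Pg i, Pg j, Pg k, Pg l]).mulVec (ket ![a, b, c, d, e, f]) =
      (Complex.I ^ ((i : ℕ) + (j : ℕ) + (k : ℕ) + (l : ℕ)) *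
        (-1 : ℂ) ^ ((i : ℕ) * (c : ℕ) + (j : ℕ) * (d : ℕ) + (k : ℕ) * (e : ℕ)
          + (l : ℕ) * (f : ℕ))) • ket ![a, b, c + 1, d + 1, e + 1, f + 1] := by
  rw [tens_mulVec_ket]
  ext r
  have key : r = ![a, b, c + 1, d + 1, e + 1, f + 1] ↔
      r 0 = a ∧ r 1 = b ∧ r 2 = c + 1 ∧ r 3 = d + 1 ∧ r 4 = e + 1 ∧ r 5 = f + 1 := by
    simp [funext_iff, Fin.forall_fin_succ]
  simp only [Pi.smul_apply, ket, key, smul_eq_mul, Fin.prod_univ_six, Matrix.cons_val,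
    Pg_apply, Matrix.one_apply]
  by_cases h0 : r 0 = a; swap
  · simp [h0]
  by_cases h1 : r 1 = b; swap
  · simp [h1]
  by_cases h2 : r 2 = c + 1; swap
  · simp [h2]
  by_cases h3 : r 3 = d + 1; swap
  · simp [h3]
  by_cases h4 : r 4 = e + 1; swap
  · simp [h4]
  by_cases h5 : r 5 = f + 1; swap
  · simp [h5]
  simp only [h0, h1, h2, h3, h4, h5, and_self, if_true]
  ring

set_option maxHeartbeats 1000000 in
theorem stmt8 (q₁ q₂ q₅ q₆ : Fin 2) (s : ℂ) (hs : s = 1 ∨ s = -1)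
    (i j k l : Fin 2) (hij : Odd ((i : ℕ) + (j : ℕ))) (hkl : Odd ((k : ℕ) + (l : ℕ))) :
    (tens ![1, 1, Pg i, Pg j, Pg k, Pg l]).mulVec (v10 q₁ q₂ q₅ q₆ s) =
      (s * Complex.I ^ ((i : ℕ) + (j : ℕ) + (k : ℕ) + (l : ℕ)) *
        (-1 : ℂ) ^ ((k : ℕ) * (q₅ : ℕ) + (l : ℕ) * (q₆ : ℕ))) • v10 q₁ q₂ q₅ q₆ s ∧
    (tens ![1, 1, Pg i, Pg j, Pg k, Pg l]).mulVec (v11 q₁ q₂ q₅ q₆ s) =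
      (s * Complex.I ^ ((i : ℕ) + (j : ℕ) + (k : ℕ) + (l : ℕ)) *
        (-1 : ℂ) ^ ((k : ℕ) * (q₅ : ℕ) + (l : ℕ) * (q₆ : ℕ) + (i : ℕ))) •
        v11 q₁ q₂ q₅ q₆ s := by
  have h11 : ∀ x : Fin 2, x + 1 + 1 = x := by decide
  have h01 : (1 : Fin 2) + 1 = 0 := rfl
  simp only [v10, v11, Matrix.mulVec_add, Matrix.mulVec_sub, Matrix.mulVec_neg,
    Matrix.mulVec_smul, tens_Pg_mulVec_ket, h11, h01, zero_add]
  generalize ket = K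
  generalize hc : Complex.I ^ ((i : ℕ) + (j : ℕ) + (k : ℕ) + (l : ℕ)) = c
  clear hc
  rcases hs with rfl | rfl <;>
  fin_cases i <;> fin_cases j <;> simp [Nat.odd_iff] at hij <;>
  fin_cases k <;> fin_cases l <;> simp [Nat.odd_iff] at hkl <;>
  fin_cases q₅ <;> fin_cases q₆ <;>
  simp <;> constructor <;> module
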